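/- Let K be a tensor-triangulated category, let b be an object of K admitting a finite filtration with graded pieces b_0, …, b_l, let y be an object of K, and let n ≥ 1 be such that Hom(b_{ψ(1)} ⊗ ⋯ ⊗ b_{ψ(n)}, y) = 0 for every function ψ : {1, …, n} → {0, …, l}. Then Hom(b^{⊗n}, y) = 0. -/

import Mathlib

open CategoryTheory CategoryTheory.Limits CategoryTheory.Pretriangulated
  CategoryTheory.MonoidalCategory

universe v u

variable {C : Type u} [Category.{v} C] [HasZeroObject C] [Preadditive C] [HasShift C ℤ]
  [∀ n : ℤ, (shiftFunctor C n).Additive] [Pretriangulated C] [MonoidalCategory C]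

/-- The tensor product `f 0 ⊗ f 1 ⊗ ⋯ ⊗ f (m-1)` of a finite family of objects
(the empty tensor product being the monoidal unit). -/
def tensorFam : ∀ {m : ℕ}, (Fin m → C) → C
  | 0, _ => 𝟙_ C
  | m + 1, f => tensorFam (fun k : Fin m => f k.castSucc) ⊗ f (Fin.last m)

/-- `b` admits a finite filtration with graded pieces `pieces 0, …, pieces (m-1)`:
there are objects `0 = b⁽⁻¹⁾, b⁽⁰⁾, …, b⁽ᵐ⁻¹⁾ = b` and distinguished triangles
`b⁽ⁱ⁻¹⁾ ⟶ b⁽ⁱ⁾ ⟶ pieces i ⟶ b⁽ⁱ⁻¹⁾[1]` for each `0 ≤ i ≤ m-1`. -/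
def HasFiniteFiltration (b : C) {m : ℕ} (pieces : Fin m → C) : Prop :=
  ∃ c : Fin (m + 1) → C, IsZero (c 0) ∧ Nonempty (c (Fin.last m) ≅ b) ∧
    ∀ i : Fin m,
      ∃ (f : c i.castSucc ⟶ c i.succ) (g : c i.succ ⟶ pieces i)
        (h : pieces i ⟶ (c i.castSucc)⟦(1 : ℤ)⟧),
        Triangle.mk f g h ∈ distTriang C

theorem filt_vanish (F : C ⥤ C) [F.CommShift ℤ] [F.IsTriangulated] (y b : C) {m : ℕ}
    (pieces : Fin m → C) (hb : HasFiniteFiltration b pieces)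
    (h : ∀ i, ∀ f : F.obj (pieces i) ⟶ y, f = 0) : ∀ f : F.obj b ⟶ y, f = 0 := by
  obtain ⟨c, hc0, ⟨e⟩, hc⟩ := hb
  have key : ∀ i : Fin (m + 1), ∀ f : F.obj (c i) ⟶ y, f = 0 := by
    intro i
    induction i using Fin.induction with
    | zero => exact fun f => (F.map_isZero hc0).eq_of_src _ _
    | succ i ih =>
      intro f
      obtain ⟨p, q, r, hT⟩ := hc i
      obtain ⟨g, hg⟩ := Triangle.yoneda_exact₂ _ (F.map_distinguished _ hT) f (ih _)
      have hg0 : g = 0 := h i g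
      rw [hg, hg0]
      exact comp_zero
  intro f
  have h1 := key _ (F.map e.hom ≫ f)
  rw [← cancel_epi (F.map e.hom), h1, comp_zero]

theorem tensor_vanish [∀ X : C, (tensorLeft X).CommShift ℤ]
    [∀ X : C, (tensorLeft X).IsTriangulated]
    [∀ X : C, (tensorRight X).CommShift ℤ] [∀ X : C, (tensorRight X).IsTriangulated]
    (b : C) {m : ℕ} (pieces : Fin m → C) (hb : HasFiniteFiltration b pieces) (y : C) (n : ℕ) :
    ∀ (F : C ⥤ C) [F.CommShift ℤ] [F.IsTriangulated],
    (∀ ψ : Fin n → Fin m, ∀ f : F.obj (tensorFam (fun k => pieces (ψ k))) ⟶ y, f = 0) →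
    ∀ f : F.obj (tensorFam (fun _ : Fin n => b)) ⟶ y, f = 0 := by
  induction n with
  | zero => exact fun F _ _ h f => h Fin.elim0 f
  | succ n ih =>
    intro F _ _ h
    refine ih (tensorRight b ⋙ F) fun ψ => ?_
    refine filt_vanish (tensorLeft (tensorFam (fun k => pieces (ψ k))) ⋙ F) y b pieces hb
      fun i => ?_
    have h2 := h (Fin.snoc (α := fun _ => Fin m) ψ i)
    have he : tensorFam (fun k => pieces (Fin.snoc (α := fun _ => Fin m) ψ i k)) =
        tensorFam (fun k => pieces (ψ k)) ⊗ pieces i := by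
      simp only [tensorFam, Fin.snoc_castSucc, Fin.snoc_last]
    rw [he] at h2
    exact h2

/-- Let `K` be a tensor-triangulated category, let `b` be an object admitting
a finite filtration with graded pieces `b_0, …, b_l`, let `y` be an object, and let `n ≥ 1`
be such that `Hom(b_{ψ(1)} ⊗ ⋯ ⊗ b_{ψ(n)}, y) = 0` for every `ψ : {1,…,n} → {0,…,l}`.
Then `Hom(b^{⊗n}, y) = 0`. -/
theorem stmt1 [∀ X : C, (tensorLeft X).CommShift ℤ] [∀ X : C, (tensorLeft X).IsTriangulated]
    [∀ X : C, (tensorRight X).CommShift ℤ] [∀ X : C, (tensorRight X).IsTriangulated]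
    (b : C) (l : ℕ) (pieces : Fin (l + 1) → C) (hb : HasFiniteFiltration b pieces)
    (y : C) (n : ℕ) (hn : 1 ≤ n)
    (h : ∀ ψ : Fin n → Fin (l + 1),
      ∀ f : tensorFam (fun k => pieces (ψ k)) ⟶ y, f = 0) :
    ∀ f : tensorFam (fun _ : Fin n => b) ⟶ y, f = 0 := by
  exact tensor_vanish b pieces hb y n (𝟭 C) h
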